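/- arXiv:2309.13765 — 2 statements merged into one kernel-verified Lean document; each statement's English description precedes it below -/
import Mathlib

section
/- Let (R, μ) be a probability measure space and let p : R → ℕ → ℝ satisfy: p r n ≥ 0 for all r, n; p r 0 = 0; ∑_{n≥1} p r n = 1 for every r; and each map r ↦ p r n is measurable. For r ∈ R define P_r(z) = ∑_{n≥1} (p r n) zⁿ for z ∈ ℂ with |z| ≤ 1. Assume ∫_R p r 1 dμ(r) > 0 and ∫_R (p r 1)² dμ(r) < ∫_R p r 1 dμ(r). Then there exist h ∈ (0,1), C > 0, and a function Φ : ℂ → ℂ analytic on the open ball {z : |z| < h}, such that |Φ(z) − z| ≤ C|z|² for |z| < h (in particular Φ(0) = 0 and Φ'(0) = 1) and, for every z with |z| < h, ∫_R Φ(P_r(z)) dμ(r) = (∫_R p r 1 dμ(r)) · Φ(z). Moreover Φ is unique in this class: if Ψ is analytic on {z : |z| < h}, satisfies |Ψ(z) − z| ≤ C|z|² for |z| < h, and satisfies the same integral functional equation for |z| < h, then Ψ = Φ on {z : |z| < h}. -/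
open MeasureTheory Metric

open Filter Topology in
lemma diff_integral {R : Type*} [MeasurableSpace R] (μ : Measure R) [IsProbabilityMeasure μ]
    (F : ℂ → R → ℂ) (h M : ℝ)
    (hm : ∀ z ∈ ball (0:ℂ) h, Measurable (F z))
    (hb : ∀ z ∈ ball (0:ℂ) h, ∀ r, ‖F z r‖ ≤ M)
    (hd : ∀ r, DifferentiableOn ℂ (fun z => F z r) (ball 0 h)) :
    DifferentiableOn ℂ (fun z => ∫ r, F z r ∂μ) (ball 0 h) := by
  intro z hz
  obtain ⟨ε, hε, hsub⟩ := Metric.isOpen_iff.1 isOpen_ball z hz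
  have hsub2 : ∀ x ∈ ball z (ε/2), closedBall x (ε/4) ⊆ ball (0:ℂ) h := by
    intro x hx y hy
    apply hsub
    rw [mem_ball] at *
    rw [mem_closedBall] at hy
    linarith [dist_triangle y x z]
  have hda : ∀ x ∈ ball z (ε/2), ∀ r, HasDerivAt (fun z => F z r) (deriv (fun z => F z r) x) x := by
    intro x hx r
    have hx' : x ∈ ball (0:ℂ) h := hsub2 x hx (mem_closedBall_self (by positivity))
    exact ((hd r).differentiableAt (isOpen_ball.mem_nhds hx')).hasDerivAt
  have key := hasDerivAt_integral_of_dominated_loc_of_deriv_le (μ := μ) (F := F) (x₀ := z)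
    (s := ball z (ε/2)) (bound := fun _ => M / (ε/4))
    (F' := fun x r => deriv (fun z => F z r) x)
    (ball_mem_nhds _ (by positivity))
    (by
      filter_upwards [isOpen_ball.mem_nhds hz] with x hx
      exact (hm x hx).aestronglyMeasurable)
    (Integrable.of_bound (hm z hz).aestronglyMeasurable M (Eventually.of_forall (hb z hz)))
    (by
      have hpos : Tendsto (fun n : ℕ => (((ε/4) * (1/((n:ℝ)+1)) : ℝ) : ℂ)) atTop (𝓝[≠] 0) := by
        refine tendsto_nhdsWithin_iff.2 ⟨?_, ?_⟩
        · have := (tendsto_one_div_add_atTop_nhds_zero_nat (𝕜 := ℝ)).const_mul (ε/4)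
          rw [mul_zero] at this
          exact_mod_cast (Complex.continuous_ofReal.tendsto 0).comp this
        · refine Eventually.of_forall fun n => ?_
          have : (0:ℝ) < (ε/4) * (1/((n:ℝ)+1)) := by positivity
          simpa only [Set.mem_compl_iff, Set.mem_singleton_iff, Complex.ofReal_eq_zero] using this.ne'
      refine Measurable.aestronglyMeasurable ?_
      refine measurable_of_tendsto_metrizable (f := fun (n : ℕ) r =>
        (((ε/4) * (1/((n:ℝ)+1)) : ℝ) : ℂ)⁻¹ • (F (z + (((ε/4) * (1/((n:ℝ)+1)) : ℝ) : ℂ)) r - F z r))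
        ?_ ?_
      · intro n
        simp only [smul_eq_mul]
        refine ((hm _ ?_).sub (hm z hz)).const_mul _
        apply hsub2 z (mem_ball_self (by positivity))
        have h0 : (0:ℝ) ≤ (ε/4) * (1/((n:ℝ)+1)) := by positivity
        rw [mem_closedBall, dist_eq_norm, add_sub_cancel_left, Complex.norm_real, Real.norm_of_nonneg h0]
        have : 1/((n:ℝ)+1) ≤ 1 := by
          rw [div_le_one (by positivity)]
          linarith [Nat.cast_nonneg (α := ℝ) n]
        nlinarith
      · rw [tendsto_pi_nhds]
        intro r
        exact (hda z (mem_ball_self (by positivity)) r).tendsto_slope_zero.comp hpos)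
    (by
      refine Eventually.of_forall fun r x hx => ?_
      refine Complex.norm_deriv_le_of_forall_mem_sphere_norm_le (by positivity) ?_ ?_
      · exact ((hd r).mono (hsub2 x hx)).diffContOnCl_ball subset_rfl
      · intro y hy
        exact hb y (hsub2 x hx (sphere_subset_closedBall hy)) r)
    (integrable_const _)
    (Eventually.of_forall fun r x hx => hda x hx r)
  exact key.2.differentiableAt.differentiableWithinAt

lemma pgf_bound (q : ℕ → ℝ) (h0 : ∀ n, 0 ≤ q n) (hz : q 0 = 0) (hs : HasSum q 1) (z : ℂ)
    (h1 : ‖z‖ < 1) :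
    ‖(∑' n, (q n : ℂ) * z ^ n) - q 1 * z‖ ≤ (1 - q 1) * ‖z‖ ^ 2 := by
  have hsum : Summable fun n => (q n : ℂ) * z ^ n := by
    refine Summable.of_norm_bounded hs.summable fun n => ?_
    rw [norm_mul, norm_pow, Complex.norm_real, Real.norm_of_nonneg (h0 n)]
    exact mul_le_of_le_one_right (h0 n) (pow_le_one₀ (norm_nonneg _) h1.le)
  have e1 := hsum.hasSum.sub (hasSum_ite_eq 1 ((q 1 : ℂ) * z))
  have e2 := (hs.sub (hasSum_ite_eq 1 (q 1))).mul_right (‖z‖ ^ 2)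
  rw [← e1.tsum_eq]
  refine tsum_of_norm_bounded e2 fun n => ?_
  rcases n with _ | _ | n
  · simp [hz]
  · simp
  · have hq := h0 (n+2)
    simp only [show n + 1 + 1 = n + 2 by rfl, show ¬ (n + 2 = 1) by omega, if_false, sub_zero,
      norm_mul, norm_pow, Complex.norm_real, Real.norm_of_nonneg hq]
    exact mul_le_mul_of_nonneg_left (pow_le_pow_of_le_one (norm_nonneg _) h1.le (by omega)) hq

lemma pgf_diff (q : ℕ → ℝ) (h0 : ∀ n, 0 ≤ q n) (hs : HasSum q 1) :
    DifferentiableOn ℂ (fun z : ℂ => ∑' n, (q n : ℂ) * z ^ n) (ball 0 1) := by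
  refine Complex.differentiableOn_tsum_of_summable_norm hs.summable (fun n => by fun_prop)
    isOpen_ball fun n w hw => ?_
  rw [mem_ball_zero_iff] at hw
  rw [norm_mul, norm_pow, Complex.norm_real, Real.norm_of_nonneg (h0 n)]
  exact mul_le_of_le_one_right (h0 n) (pow_le_one₀ (norm_nonneg _) hw.le)

lemma pgf_meas {R : Type*} [MeasurableSpace R] (p : R → ℕ → ℝ) (h0 : ∀ r n, 0 ≤ p r n)
    (hs : ∀ r, HasSum (p r) 1) (hm : ∀ n, Measurable fun r => p r n) (z : ℂ) (h1 : ‖z‖ < 1) :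
    Measurable fun r => ∑' n, (p r n : ℂ) * z ^ n := by
  refine measurable_of_tendsto_metrizable (f := fun (N : ℕ) r =>
    ∑ n ∈ Finset.range N, (p r n : ℂ) * z ^ n) (fun N => ?_) ?_
  · refine Finset.measurable_fun_sum _ fun n _ => ?_
    exact (Complex.measurable_ofReal.comp (hm n)).mul_const _
  · rw [tendsto_pi_nhds]
    intro r
    refine HasSum.tendsto_sum_nat (Summable.hasSum ?_)
    refine Summable.of_norm_bounded (hs r).summable fun n => ?_
    rw [norm_mul, norm_pow, Complex.norm_real, Real.norm_of_nonneg (h0 r n)]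
    exact mul_le_of_le_one_right (h0 r n) (pow_le_one₀ (norm_nonneg _) h1.le)

lemma comp_meas {R : Type*} [MeasurableSpace R] (f : ℂ → ℂ) (h : ℝ)
    (hf : ContinuousOn f (ball 0 h)) (g : R → ℂ) (hg : Measurable g) (hgb : ∀ r, g r ∈ ball (0:ℂ) h) :
    Measurable fun r => f (g r) := by
  classical
  have := (hf.measurable_piecewise (continuousOn_const (c := (0:ℂ))) measurableSet_ball).comp hg
  convert this using 1
  ext r
  simp only [Function.comp]
  rw [Set.piecewise_eq_of_mem _ _ _ (hgb r)]

open Filter Topology in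
/-- Abstract version of the main theorem. -/
lemma abstract_main {R : Type*} [MeasurableSpace R] (μ : Measure R) [IsProbabilityMeasure μ]
    (P : R → ℂ → ℂ) (q : R → ℝ) (h m κ : ℝ) (hh : 0 < h) (hh1 : h < 1) (hm : 0 < m)
    (hκ0 : 0 ≤ κ) (hκ : κ < 1) (hqi : Integrable q μ) (hq2 : Integrable (fun r => q r ^ 2) μ)
    (hqm : ∫ r, q r ∂μ = m)
    (hq2m : ∫ r, (q r ^ 2 + 2 * h) ∂μ = κ * m)
    (hPm : ∀ z, ‖z‖ < h → Measurable fun r => P r z)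
    (hPd : ∀ r, DifferentiableOn ℂ (P r) (ball 0 h))
    (hP1 : ∀ r z, ‖z‖ < h → ‖P r z‖ ≤ ‖z‖)
    (hP2 : ∀ r z, ‖z‖ < h → ‖P r z - q r * z‖ ≤ ‖z‖ ^ 2)
    (hP3 : ∀ r z, ‖z‖ < h → ‖P r z‖ ^ 2 ≤ (q r ^ 2 + 2 * h) * ‖z‖ ^ 2) :
    ∃ C > (0 : ℝ), ∃ Φ : ℂ → ℂ,
      AnalyticOnNhd ℂ Φ (ball (0 : ℂ) h) ∧
      (∀ z : ℂ, ‖z‖ < h → ‖Φ z - z‖ ≤ C * ‖z‖ ^ 2) ∧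
      (∀ z : ℂ, ‖z‖ < h → ∫ r, Φ (P r z) ∂μ = (m : ℂ) * Φ z) ∧
      (∀ Ψ : ℂ → ℂ,
        AnalyticOnNhd ℂ Ψ (ball (0 : ℂ) h) →
        (∀ z : ℂ, ‖z‖ < h → ‖Ψ z - z‖ ≤ C * ‖z‖ ^ 2) →
        (∀ z : ℂ, ‖z‖ < h → ∫ r, Ψ (P r z) ∂μ = (m : ℂ) * Ψ z) →
        ∀ z : ℂ, ‖z‖ < h → Ψ z = Φ z) := by
  have hPin : ∀ r z, ‖z‖ < h → ‖P r z‖ < h := fun r z hz => (hP1 r z hz).trans_lt hz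
  set C : ℝ := m⁻¹ / (1 - κ) with hC
  have h1κ : 0 < 1 - κ := by linarith
  have hCpos : 0 < C := by positivity
  have hCeq : κ * C + m⁻¹ = C := by rw [hC]; field_simp; ring
  let A : (ℂ → ℂ) → Prop := fun f => DifferentiableOn ℂ f (ball 0 h) ∧
    ∀ z : ℂ, ‖z‖ < h → ‖f z - z‖ ≤ C * ‖z‖ ^ 2
  let T : (ℂ → ℂ) → ℂ → ℂ := fun f z => (m : ℂ)⁻¹ * ∫ r, f (P r z) ∂μ
  have hmC : (m : ℂ) ≠ 0 := by exact_mod_cast hm.ne'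
  have hAid : A (fun z => z) := ⟨differentiableOn_id, fun z _ => by simp; positivity⟩
  have hAb : ∀ f, A f → ∀ z, ‖z‖ < h → ‖f z‖ ≤ 1 + C := by
    intro f hf z hz
    have h2 := hf.2 z hz
    have h3 : ‖f z‖ ≤ ‖f z - z‖ + ‖z‖ := by simpa using norm_add_le (f z - z) z
    have h4 : ‖z‖ ^ 2 ≤ 1 := pow_le_one₀ (norm_nonneg _) (by linarith)
    nlinarith
  have hAm : ∀ f, A f → ∀ z, ‖z‖ < h → Measurable fun r => f (P r z) := by
    intro f hf z hz
    exact comp_meas f h hf.1.continuousOn _ (hPm z hz) fun r => by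
      simpa using hPin r z hz
  have hAi : ∀ f, A f → ∀ z, ‖z‖ < h → Integrable (fun r => f (P r z)) μ := by
    intro f hf z hz
    exact Integrable.of_bound (hAm f hf z hz).aestronglyMeasurable (1 + C)
      (Eventually.of_forall fun r => hAb f hf _ (hPin r z hz))
  -- contraction
  have hcontr : ∀ f g K, A f → A g → (∀ z, ‖z‖ < h → ‖f z - g z‖ ≤ K * ‖z‖ ^ 2) → 0 ≤ K →
      ∀ z, ‖z‖ < h → ‖T f z - T g z‖ ≤ (κ * K) * ‖z‖ ^ 2 := by
    intro f g K hf hg hfg hK z hz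
    have e : T f z - T g z = (m : ℂ)⁻¹ * ∫ r, (f (P r z) - g (P r z)) ∂μ := by
      rw [integral_sub (hAi f hf z hz) (hAi g hg z hz), mul_sub]
    have b : ‖∫ r, (f (P r z) - g (P r z)) ∂μ‖ ≤ ∫ r, (q r ^ 2 + 2 * h) * (K * ‖z‖ ^ 2) ∂μ := by
      refine norm_integral_le_of_norm_le ((hq2.add (integrable_const _)).mul_const _)
        (Eventually.of_forall fun r => ?_)
      refine (hfg _ (hPin r z hz)).trans ?_
      have := mul_le_mul_of_nonneg_left (hP3 r z hz) hK
      linarith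
    rw [integral_mul_const, hq2m] at b
    rw [e, norm_mul, norm_inv, Complex.norm_real, Real.norm_of_nonneg hm.le]
    calc m⁻¹ * _ ≤ m⁻¹ * (κ * m * (K * ‖z‖ ^ 2)) := by gcongr
      _ = _ := by field_simp
  have hTid : ∀ z, ‖z‖ < h → ‖T (fun z => z) z - z‖ ≤ m⁻¹ * ‖z‖ ^ 2 := by
    intro z hz
    have hi : Integrable (fun r => (q r : ℂ) * z) μ := hqi.ofReal.mul_const z
    have e : T (fun z => z) z - z = (m : ℂ)⁻¹ * ∫ r, (P r z - q r * z) ∂μ := by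
      rw [integral_sub (hAi _ hAid z hz) hi, integral_mul_const, integral_complex_ofReal, hqm,
        mul_sub, inv_mul_cancel_left₀ hmC]
    have b : ‖∫ r, (P r z - q r * z) ∂μ‖ ≤ ∫ r, ‖z‖ ^ 2 ∂μ :=
      norm_integral_le_of_norm_le (integrable_const _) (Eventually.of_forall fun r => hP2 r z hz)
    rw [integral_const, probReal_univ, one_smul] at b
    rw [e, norm_mul, norm_inv, Complex.norm_real, Real.norm_of_nonneg hm.le]
    gcongr
  have hAT : ∀ f, A f → A (T f) := by
    intro f hf
    refine ⟨?_, fun z hz => ?_⟩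
    · refine DifferentiableOn.const_mul ?_ _
      refine diff_integral μ (fun z r => f (P r z)) h (1 + C) (fun z hz => ?_) (fun z hz r => ?_)
        fun r => ?_
      · exact hAm f hf z (by simpa using hz)
      · exact hAb f hf _ (hPin r z (by simpa using hz))
      · refine hf.1.comp (hPd r) fun z hz => ?_
        simpa using hPin r z (by simpa using hz)
    · have a := hcontr f _ C hf hAid hf.2 hCpos.le z hz
      have b := hTid z hz
      have c := norm_sub_le_norm_sub_add_norm_sub (T f z) (T (fun z => z) z) z
      have : C * ‖z‖ ^ 2 = κ * C * ‖z‖ ^ 2 + m⁻¹ * ‖z‖ ^ 2 := by rw [← add_mul, hCeq]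
      linarith
  let F : ℕ → ℂ → ℂ := fun n => T^[n] (fun z => z)
  have hFs : ∀ n, F (n+1) = T (F n) := fun n => Function.iterate_succ_apply' _ _ _
  have hFA : ∀ n, A (F n) := by
    intro n
    induction n with
    | zero => exact hAid
    | succ n ih => rw [hFs]; exact hAT _ ih
  have hFd : ∀ n z, ‖z‖ < h → ‖F n z - F (n+1) z‖ ≤ (κ ^ n * m⁻¹) * ‖z‖ ^ 2 := by
    intro n
    induction n with
    | zero =>
      intro z hz
      rw [norm_sub_rev]
      simpa [F] using hTid z hz
    | succ n ih =>
      intro z hz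
      rw [hFs n, hFs (n+1)]
      have := hcontr _ _ _ (hFA n) (hFA (n+1)) ih (by positivity) z hz
      rw [pow_succ']
      linarith
  have hFd' : ∀ z, ‖z‖ < h → ∀ n, dist (F n z) (F (n+1) z) ≤ m⁻¹ * κ ^ n := by
    intro z hz n
    rw [dist_eq_norm]
    have h4 : ‖z‖ ^ 2 ≤ 1 := pow_le_one₀ (norm_nonneg _) (by linarith)
    have : 0 ≤ κ ^ n * m⁻¹ := by positivity
    nlinarith [hFd n z hz]
  have hex : ∀ z, ∃ w, ‖z‖ < h → Tendsto (fun n => F n z) atTop (𝓝 w) := by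
    intro z
    by_cases hz : ‖z‖ < h
    · obtain ⟨w, hw⟩ := cauchySeq_tendsto_of_complete
        (cauchySeq_of_le_geometric _ _ hκ (hFd' z hz))
      exact ⟨w, fun _ => hw⟩
    · exact ⟨0, fun hz' => absurd hz' hz⟩
  choose Φ hΦ using hex
  have hpow : Tendsto (fun n : ℕ => m⁻¹ * κ ^ n / (1 - κ)) atTop (𝓝 0) := by
    have := ((tendsto_pow_atTop_nhds_zero_of_lt_one hκ0 hκ).const_mul m⁻¹).div_const (1 - κ)
    simpa using this
  have hunif : TendstoUniformlyOn F Φ atTop (ball 0 h) := by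
    rw [Metric.tendstoUniformlyOn_iff]
    intro ε hε
    filter_upwards [hpow.eventually (gt_mem_nhds hε)] with n hn z hz
    rw [mem_ball_zero_iff] at hz
    rw [dist_comm]
    exact (dist_le_of_le_geometric_of_tendsto _ _ hκ (hFd' z hz) (hΦ z hz) n).trans_lt hn
  have hΦA : A Φ := by
    refine ⟨hunif.tendstoLocallyUniformlyOn.differentiableOn
      (Eventually.of_forall fun n => (hFA n).1) isOpen_ball, fun z hz => ?_⟩
    exact le_of_tendsto ((hΦ z hz).sub_const z).norm (Eventually.of_forall fun n => (hFA n).2 z hz)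
  refine ⟨C, hCpos, Φ, hΦA.1.analyticOnNhd isOpen_ball, hΦA.2, fun z hz => ?_, ?_⟩
  · have t1 : Tendsto (fun n => ∫ r, F n (P r z) ∂μ) atTop (𝓝 (∫ r, Φ (P r z) ∂μ)) :=
      tendsto_integral_of_dominated_convergence (fun _ => 1 + C)
        (fun n => (hAm _ (hFA n) z hz).aestronglyMeasurable) (integrable_const _)
        (fun n => Eventually.of_forall fun r => hAb _ (hFA n) _ (hPin r z hz))
        (Eventually.of_forall fun r => hΦ _ (hPin r z hz))
    have t2 : Tendsto (fun n => (m : ℂ) * F (n+1) z) atTop (𝓝 ((m : ℂ) * Φ z)) :=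
      ((hΦ z hz).comp (tendsto_add_atTop_nat 1)).const_mul _
    refine tendsto_nhds_unique t1 (t2.congr fun n => ?_)
    rw [hFs]
    exact mul_inv_cancel_left₀ hmC _
  · intro Ψ hΨa hΨb hΨe z hz
    have hΨA : A Ψ := ⟨hΨa.differentiableOn, hΨb⟩
    have hTΨ : ∀ z, ‖z‖ < h → T Ψ z = Ψ z := fun z hz => by
      simp only [T]
      rw [hΨe z hz, inv_mul_cancel_left₀ hmC]
    have hit : ∀ n z, ‖z‖ < h → ‖F n z - Ψ z‖ ≤ (κ ^ n * C) * ‖z‖ ^ 2 := by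
      intro n
      induction n with
      | zero =>
        intro z hz
        rw [norm_sub_rev]
        simpa [F] using hΨb z hz
      | succ n ih =>
        intro z hz
        have := hcontr _ _ _ (hFA n) hΨA ih (by positivity) z hz
        rw [hFs, ← hTΨ z hz, pow_succ']
        linarith
    refine tendsto_nhds_unique ?_ (hΦ z hz)
    rw [tendsto_iff_norm_sub_tendsto_zero]
    refine squeeze_zero (fun n => norm_nonneg _) (fun n => hit n z hz) ?_
    simpa using ((tendsto_pow_atTop_nhds_zero_of_lt_one hκ0 hκ).mul_const C).mul_const (‖z‖ ^ 2)

theorem stmt_0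
    {R : Type*} [MeasurableSpace R] (μ : Measure R) [IsProbabilityMeasure μ]
    (p : R → ℕ → ℝ)
    (hp_nonneg : ∀ r n, 0 ≤ p r n)
    (hp_zero : ∀ r, p r 0 = 0)
    (hp_sum : ∀ r, ∑' n, p r n = 1)
    (hp_meas : ∀ n, Measurable fun r => p r n)
    (hp1_pos : 0 < ∫ r, p r 1 ∂μ)
    (hp1_sq : ∫ r, (p r 1) ^ 2 ∂μ < ∫ r, p r 1 ∂μ) :
    ∃ h ∈ Set.Ioo (0 : ℝ) 1, ∃ C > (0 : ℝ), ∃ Φ : ℂ → ℂ,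
      AnalyticOnNhd ℂ Φ (ball (0 : ℂ) h) ∧
      (∀ z : ℂ, ‖z‖ < h → ‖Φ z - z‖ ≤ C * ‖z‖ ^ 2) ∧
      (∀ z : ℂ, ‖z‖ < h →
        ∫ r, Φ (∑' n, (p r n : ℂ) * z ^ n) ∂μ = ((∫ r, p r 1 ∂μ : ℝ) : ℂ) * Φ z) ∧
      (∀ Ψ : ℂ → ℂ,
        AnalyticOnNhd ℂ Ψ (ball (0 : ℂ) h) →
        (∀ z : ℂ, ‖z‖ < h → ‖Ψ z - z‖ ≤ C * ‖z‖ ^ 2) →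
        (∀ z : ℂ, ‖z‖ < h →
          ∫ r, Ψ (∑' n, (p r n : ℂ) * z ^ n) ∂μ = ((∫ r, p r 1 ∂μ : ℝ) : ℂ) * Ψ z) →
        ∀ z : ℂ, ‖z‖ < h → Ψ z = Φ z) := by
  have hs : ∀ r, HasSum (p r) 1 := by
    intro r
    have : Summable (p r) := by
      by_contra hn
      have := hp_sum r
      rw [tsum_eq_zero_of_not_summable hn] at this
      exact zero_ne_one this
    rw [← hp_sum r]
    exact this.hasSum
  have hle : ∀ r, p r 1 ≤ 1 := fun r => le_hasSum (hs r) 1 fun n _ => hp_nonneg r n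
  set m := ∫ r, p r 1 ∂μ with hm
  set s := ∫ r, (p r 1) ^ 2 ∂μ with hsdef
  have hs0 : 0 ≤ s := integral_nonneg fun r => sq_nonneg _
  have hqi : Integrable (fun r => p r 1) μ :=
    Integrable.of_bound (hp_meas 1).aestronglyMeasurable 1 (Filter.Eventually.of_forall fun r => by
      rw [Real.norm_of_nonneg (hp_nonneg r 1)]; exact hle r)
  have hq2 : Integrable (fun r => p r 1 ^ 2) μ :=
    Integrable.of_bound ((hp_meas 1).pow_const 2).aestronglyMeasurable 1
      (Filter.Eventually.of_forall fun r => by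
        rw [Real.norm_of_nonneg (sq_nonneg _)]; exact pow_le_one₀ (hp_nonneg r 1) (hle r))
  obtain ⟨h, hh, hh1, hh2⟩ : ∃ h : ℝ, 0 < h ∧ h < 1 ∧ s + 2 * h < m := by
    refine ⟨min (1/2) ((m - s)/4), lt_min (by norm_num) (by linarith), ?_, ?_⟩
    · exact (min_le_left _ _).trans_lt (by norm_num)
    · have := min_le_right (1/2) ((m - s)/4)
      linarith
  have hbd : ∀ r z, ‖z‖ < h → ‖∑' n, (p r n : ℂ) * z ^ n‖ ≤ ‖z‖ * (p r 1 + (1 - p r 1) * ‖z‖) := by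
    intro r z hz
    have b := pgf_bound (p r) (hp_nonneg r) (hp_zero r) (hs r) z (hz.trans hh1)
    have t := norm_add_le ((∑' n, (p r n : ℂ) * z ^ n) - p r 1 * z) (p r 1 * z)
    rw [sub_add_cancel, norm_mul, Complex.norm_real, Real.norm_of_nonneg (hp_nonneg r 1)] at t
    linarith
  refine ⟨h, ⟨hh, hh1⟩, ?_⟩
  refine abstract_main μ (fun r z => ∑' n, (p r n : ℂ) * z ^ n) (fun r => p r 1) h m
    ((s + 2 * h) / m) hh hh1 hp1_pos (by positivity) ((div_lt_one hp1_pos).2 hh2) hqi hq2 rfl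
    ?_ ?_ ?_ ?_ ?_ ?_
  · rw [integral_add hq2 (integrable_const _), div_mul_cancel₀ _ hp1_pos.ne']
    simp [hsdef]
  · exact fun z hz => pgf_meas p hp_nonneg hs hp_meas z (hz.trans hh1)
  · exact fun r => (pgf_diff (p r) (hp_nonneg r) (hs r)).mono (ball_subset_ball hh1.le)
  · intro r z hz
    refine (hbd r z hz).trans (mul_le_of_le_one_right (norm_nonneg _) ?_)
    nlinarith [hle r]
  · intro r z hz
    refine (pgf_bound (p r) (hp_nonneg r) (hp_zero r) (hs r) z (hz.trans hh1)).trans ?_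
    exact mul_le_of_le_one_left (by positivity) (by linarith [hp_nonneg r 1])
  · intro r z hz
    have h1 := hle r
    have h0 := hp_nonneg r 1
    have hz0 := norm_nonneg z
    have b : ‖∑' n, (p r n : ℂ) * z ^ n‖ ^ 2 ≤ (‖z‖ * (p r 1 + (1 - p r 1) * ‖z‖)) ^ 2 := by
      gcongr
      exact hbd r z hz
    refine b.trans ?_
    rw [mul_pow, mul_comm]
    refine mul_le_mul_of_nonneg_right ?_ (by positivity)
    generalize p r 1 = a at *
    generalize ‖z‖ = x at *
    have e1 : (1 - a) * x ≤ h := by nlinarith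
    have e0 : 0 ≤ (1 - a) * x := mul_nonneg (by linarith) hz0
    have e2 : 2 * a + (1 - a) * x ≤ 2 := by nlinarith
    have e3 : ((1 - a) * x) * (2 * a + (1 - a) * x) ≤ h * 2 :=
      mul_le_mul e1 e2 (by positivity) hh.le
    nlinarith
end

section
/- Let (R, μ) be a probability measure space and let p : R → ℕ → ℝ satisfy: p r n ≥ 0 for all r, n; p r 0 = 0; ∑_{n≥1} p r n = 1 for every r; each map r ↦ p r n is measurable; ∫_R p r 1 dμ(r) > 0; and there exists δ ∈ (0,1) with p r 1 ≤ 1 − δ for all r ∈ R. For r ∈ R define P_r(z) = ∑_{n≥1} (p r n) zⁿ. Then there exists a function Φ : ℂ → ℂ analytic on the open unit disk {z : |z| < 1} with Φ(0) = 0 and Φ'(0) = 1, satisfying ∫_R Φ(P_r(z)) dμ(r) = (∫_R p r 1 dμ(r)) · Φ(z) for all |z| < 1, and there exists a real number α < 0 such that |Φ(z)| ≤ (1 − |z|)^α for all z with |z| < 1. -/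
open MeasureTheory Metric

/-- Holomorphic dependence of an integral on a parameter. -/
theorem aux_holo {R : Type*} [MeasurableSpace R] (μ : Measure R) [IsProbabilityMeasure μ]
    (f : R → ℂ → ℂ) (B : ℝ → ℝ)
    (hf : ∀ r, DifferentiableOn ℂ (f r) (ball 0 1))
    (hm : ∀ z, ‖z‖ < 1 → AEStronglyMeasurable (fun r => f r z) μ)
    (hB : ∀ r z ρ, ‖z‖ ≤ ρ → ρ < 1 → ‖f r z‖ ≤ B ρ) :
    DifferentiableOn ℂ (fun z => ∫ r, f r z ∂μ) (ball 0 1) := by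
  intro z₀ hz₀
  rw [mem_ball_zero_iff] at hz₀
  set ε : ℝ := (1 - ‖z₀‖) / 4 with hε
  have hεpos : 0 < ε := by rw [hε]; linarith
  have hρ : ‖z₀‖ + 2 * ε < 1 := by rw [hε]; linarith
  have hnear : ∀ x ∈ ball z₀ ε, ∀ w ∈ closedBall x ε, ‖w‖ ≤ ‖z₀‖ + 2 * ε := by
    intro x hx w hw
    rw [mem_ball, dist_eq_norm] at hx
    rw [mem_closedBall, dist_eq_norm] at hw
    have : w = (w - x) + (x - z₀) + z₀ := by ring
    rw [this]
    have h1 := norm_add_le ((w - x) + (x - z₀)) z₀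
    have h2 := norm_add_le (w - x) (x - z₀)
    linarith
  have hball : ∀ x ∈ ball z₀ ε, ‖x‖ < 1 := fun x hx =>
    lt_of_le_of_lt (hnear x hx x (mem_closedBall_self hεpos.le)) hρ
  have hda : ∀ r, ∀ x, ‖x‖ < 1 → HasDerivAt (f r) (deriv (f r) x) x := fun r x hx =>
    ((hf r).differentiableAt (isOpen_ball.mem_nhds (by simpa using hx))).hasDerivAt
  have key := hasDerivAt_integral_of_dominated_loc_of_deriv_le (μ := μ) (𝕜 := ℂ)
    (F := fun z r => f r z) (F' := fun z r => deriv (f r) z) (x₀ := z₀) (s := ball z₀ ε)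
    (bound := fun _ => B (‖z₀‖ + 2 * ε) / ε)
    (ball_mem_nhds z₀ hεpos)
    (by filter_upwards [ball_mem_nhds z₀ hεpos] with x hx using hm x (hball x hx))
    (Integrable.of_bound (hm z₀ hz₀) (B ‖z₀‖)
      (Filter.Eventually.of_forall fun r => hB r z₀ _ le_rfl hz₀))
    ?_
    (Filter.Eventually.of_forall fun r x hx => by
      refine Complex.norm_deriv_le_of_forall_mem_sphere_norm_le hεpos ?_ ?_
      · refine ((hf r).mono ?_).diffContOnCl
        refine closure_ball_subset_closedBall.trans ?_
        intro w hw
        rw [mem_ball_zero_iff]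
        exact lt_of_le_of_lt (hnear x hx w hw) hρ
      · intro w hw
        exact hB r w _ (hnear x hx w (sphere_subset_closedBall hw)) hρ)
    (integrable_const _)
    (Filter.Eventually.of_forall fun r x hx => hda r x (hball x hx))
  · exact key.2.differentiableAt.differentiableWithinAt
  · -- measurability of the derivative
    have hu : Filter.Tendsto (fun k : ℕ => z₀ + ((1 / ((k : ℝ) + 1) : ℝ) : ℂ)) Filter.atTop
        (nhdsWithin z₀ {z₀}ᶜ) := by
      rw [tendsto_nhdsWithin_iff]
      constructor
      · have h := tendsto_one_div_add_atTop_nhds_zero_nat (𝕜 := ℝ)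
        have h2 := (Complex.continuous_ofReal.tendsto 0).comp h
        have h3 := h2.const_add z₀
        simpa [Function.comp_def] using h3
      · refine Filter.Eventually.of_forall fun k => ?_
        simp only [Set.mem_compl_iff, Set.mem_singleton_iff, add_eq_left, Complex.ofReal_eq_zero]
        positivity
    have hev : ∀ᶠ k : ℕ in Filter.atTop, ‖z₀ + ((1 / ((k : ℝ) + 1) : ℝ) : ℂ)‖ < 1 := by
      have h1 := hu.mono_right nhdsWithin_le_nhds
      exact (h1.norm).eventually (gt_mem_nhds hz₀)
    obtain ⟨K, hK⟩ := Filter.eventually_atTop.1 hev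
    refine aestronglyMeasurable_of_tendsto_ae (Filter.atTop : Filter ℕ)
      (f := fun k r => slope (f r) z₀ (z₀ + ((1 / (((k + K : ℕ) : ℝ) + 1) : ℝ) : ℂ))) ?_ ?_
    · intro k
      simp only [slope, vsub_eq_sub]
      have h1 := (hm _ (hK (k + K) (Nat.le_add_left _ _))).sub (hm z₀ hz₀)
      exact h1.const_smul ((z₀ + ((1 / (((k + K : ℕ) : ℝ) + 1) : ℝ) : ℂ) - z₀)⁻¹ : ℂ)
    · refine Filter.Eventually.of_forall fun r => ?_
      have h := (hda r z₀ hz₀).tendsto_slope.comp hu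
      exact h.comp (Filter.tendsto_add_atTop_nat K)

theorem aux_H_mono (N : ℕ) {x y : ℝ} (hy : 0 ≤ y) (hyx : y ≤ x) (hx : x < 1) :
    y ^ 2 / (1 - y) ^ N ≤ x ^ 2 / (1 - x) ^ N := by
  have : 0 < 1 - x := by linarith
  gcongr

theorem aux_H_step (N : ℕ) {x y q δ : ℝ} (hδ : 0 < δ) (hδ1 : δ < 1) (hy : 0 ≤ y) (hx0 : 0 ≤ x)
    (hx : x < 1) (hq0 : 0 ≤ q) (hq : q ≤ 1 - δ) (hyx : y ≤ x * (q + (1 - q) * x)) :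
    y ^ 2 / (1 - y) ^ N ≤
      (q + (1 - q) * x) * ((1 - δ + δ * x) / (1 + δ * x) ^ N * (x ^ 2 / (1 - x) ^ N)) := by
  have h1 : q + (1 - q) * x ≤ 1 - δ + δ * x := by nlinarith
  have h0 : 0 ≤ q + (1 - q) * x := by nlinarith
  have h2 : y ≤ x * (1 - δ + δ * x) := hyx.trans (by gcongr)
  have h3 : (1 - x) * (1 + δ * x) ≤ 1 - y := by nlinarith
  have h4 : 0 < 1 - x := by linarith
  have h5 : 0 < 1 + δ * x := by positivity
  calc y ^ 2 / (1 - y) ^ N ≤ y ^ 2 / ((1 - x) * (1 + δ * x)) ^ N := by gcongr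
    _ ≤ ((q + (1 - q) * x) * (1 - δ + δ * x) * x ^ 2) / ((1 - x) * (1 + δ * x)) ^ N := by
        gcongr
        calc y ^ 2 ≤ (x * (q + (1 - q) * x)) ^ 2 := by gcongr
          _ = (q + (1 - q) * x) * (q + (1 - q) * x) * x ^ 2 := by ring
          _ ≤ _ := by gcongr
    _ = _ := by rw [mul_pow]; field_simp

theorem aux_const (N : ℕ) {x m δ : ℝ} (hδ : 0 < δ) (hδ1 : δ < 1) (hx0 : 0 ≤ x) (hx : x < 1)
    (hm : 0 < m) (hN : 1 ≤ N * δ * m) :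
    (m + (1 - m) * x) * ((1 - δ + δ * x) / (1 + δ * x) ^ (N + 1)) ≤ m * (1 - δ / 2) := by
  have h5 : 0 < 1 + δ * x := by positivity
  have hb : 1 + (N : ℝ) * (δ * x) ≤ (1 + δ * x) ^ N :=
    one_add_mul_le_pow (by nlinarith [mul_nonneg hδ.le hx0]) N
  have h1 : m + (1 - m) * x ≤ m * (1 + δ * x) ^ N := by
    have : m * (1 + (N : ℝ) * (δ * x)) ≤ m * (1 + δ * x) ^ N := by gcongr
    nlinarith [mul_le_mul_of_nonneg_right hN hx0, mul_nonneg hm.le hx0]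
  have h2 : 1 - δ + δ * x ≤ (1 - δ / 2) * (1 + δ * x) := by
    nlinarith [mul_nonneg hδ.le hx0, mul_nonneg (mul_nonneg hδ.le hδ.le) (by linarith : 0 ≤ 1 - x)]
  have h3 : 0 ≤ 1 - δ + δ * x := by nlinarith [mul_nonneg hδ.le hx0]
  rw [mul_div_assoc', div_le_iff₀ (by positivity)]
  calc (m + (1 - m) * x) * (1 - δ + δ * x)
      ≤ (m * (1 + δ * x) ^ N) * ((1 - δ / 2) * (1 + δ * x)) := by gcongr
    _ = _ := by ring

theorem aux_ind (g : ℂ → ℂ) (hg : ContinuousOn g (ball 0 1)) :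
    Measurable ((ball (0 : ℂ) 1).indicator g) := by
  classical
  rw [← Set.piecewise_eq_indicator]
  exact ContinuousOn.measurable_piecewise hg continuousOn_const measurableSet_ball

/-- Abstract version. -/
theorem aux_main {R : Type*} [MeasurableSpace R] (μ : Measure R) [IsProbabilityMeasure μ]
    (F : R → ℂ → ℂ) (q : R → ℝ) (δ : ℝ) (hδ : 0 < δ) (hδ1 : δ < 1)
    (hq0 : ∀ r, 0 ≤ q r) (hq : ∀ r, q r ≤ 1 - δ) (hqm : Measurable q)
    (hqpos : 0 < ∫ r, q r ∂μ)
    (hF : ∀ r, DifferentiableOn ℂ (F r) (ball 0 1))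
    (hFm : ∀ z, ‖z‖ < 1 → Measurable fun r => F r z)
    (hFb : ∀ r z, ‖z‖ < 1 → ‖F r z - q r * z‖ ≤ (1 - q r) * ‖z‖ ^ 2) :
    ∃ Φ : ℂ → ℂ,
      AnalyticOnNhd ℂ Φ (ball (0 : ℂ) 1) ∧
      Φ 0 = 0 ∧ deriv Φ 0 = 1 ∧
      (∀ z : ℂ, ‖z‖ < 1 →
        ∫ r, Φ (F r z) ∂μ = ((∫ r, q r ∂μ : ℝ) : ℂ) * Φ z) ∧
      ∃ α : ℝ, α < 0 ∧ ∀ z : ℂ, ‖z‖ < 1 → ‖Φ z‖ ≤ (1 - ‖z‖) ^ α := by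
  set m : ℝ := ∫ r, q r ∂μ with hmdef
  have hmC : (m : ℂ) ≠ 0 := by exact_mod_cast hqpos.ne'
  have hqi : Integrable q μ := Integrable.of_bound hqm.aestronglyMeasurable 1
    (Filter.Eventually.of_forall fun r => by
      rw [Real.norm_of_nonneg (hq0 r)]; linarith [hq r])
  have hmint : ∀ x : ℝ, ∫ r, (q r + (1 - q r) * x) ∂μ = m + (1 - m) * x := by
    intro x
    have h1 : Integrable (fun r => (1 - q r) * x) μ :=
      ((integrable_const (1 : ℝ)).sub hqi).mul_const x
    rw [integral_add hqi h1, integral_mul_const, integral_sub (integrable_const _) hqi]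
    simp [hmdef]
  have hqxi : ∀ x : ℝ, Integrable (fun r => q r + (1 - q r) * x) μ := fun x =>
    hqi.add (((integrable_const (1 : ℝ)).sub hqi).mul_const x)
  obtain ⟨N₀, hN₀⟩ := exists_nat_ge (1 / (δ * m))
  have hN₀' : 1 ≤ N₀ * δ * m := by
    rw [div_le_iff₀ (by positivity)] at hN₀
    linarith
  set N := N₀ + 1 with hN
  set H : ℝ → ℝ := fun x => x ^ 2 / (1 - x) ^ N with hH
  set θ : ℝ := 1 - δ / 2 with hθ
  have hθ0 : 0 ≤ θ := by rw [hθ]; linarith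
  have hθ1 : θ < 1 := by rw [hθ]; linarith
  have hHnn : ∀ x, 0 ≤ x → x < 1 → 0 ≤ H x := fun x h0 h1 => by
    have : 0 < 1 - x := by linarith
    simp only [hH]; positivity
  -- bound on F
  have hFn : ∀ r z, ‖z‖ < 1 → ‖F r z‖ ≤ ‖z‖ * (q r + (1 - q r) * ‖z‖) := by
    intro r z hz
    have h1 := norm_add_le (F r z - q r * z) (q r * z)
    rw [sub_add_cancel, norm_mul, Complex.norm_real, Real.norm_of_nonneg (hq0 r)] at h1
    nlinarith [hFb r z hz]
  have hFle : ∀ r z, ‖z‖ < 1 → ‖F r z‖ ≤ ‖z‖ := by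
    intro r z hz
    refine (hFn r z hz).trans ?_
    have : q r + (1 - q r) * ‖z‖ ≤ 1 := by nlinarith [hq r, norm_nonneg z]
    exact mul_le_of_le_one_right (norm_nonneg z) this
  have hFlt : ∀ r z, ‖z‖ < 1 → ‖F r z‖ < 1 := fun r z hz => (hFle r z hz).trans_lt hz
  -- measurability of compositions
  have hcm : ∀ g : ℂ → ℂ, ContinuousOn g (ball 0 1) → ∀ z, ‖z‖ < 1 →
      AEStronglyMeasurable (fun r => g (F r z)) μ := by
    intro g hg z hz
    have h1 : Measurable ((ball (0 : ℂ) 1).indicator g) :=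
      aux_ind g hg
    have h2 := h1.comp (hFm z hz)
    have h3 : ((ball (0 : ℂ) 1).indicator g) ∘ (fun r => F r z) = fun r => g (F r z) := by
      funext r
      exact Set.indicator_of_mem (by simpa using hFlt r z hz) g
    rw [h3] at h2
    exact h2.aestronglyMeasurable
  -- the operator
  set T : (ℂ → ℂ) → ℂ → ℂ := fun g z => (m : ℂ)⁻¹ * ∫ r, g (F r z) ∂μ with hT
  have hint : ∀ g : ℂ → ℂ, DifferentiableOn ℂ g (ball 0 1) → ∀ C : ℝ, 0 ≤ C →
      (∀ z, ‖z‖ < 1 → ‖g z‖ ≤ C * H ‖z‖) → ∀ z, ‖z‖ < 1 →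
      Integrable (fun r => g (F r z)) μ ∧ ∫ r, ‖g (F r z)‖ ∂μ ≤ m * (C * θ * H ‖z‖) := by
    intro g hg C hC hgb z hz
    have hI : Integrable (fun r => g (F r z)) μ := by
      refine Integrable.of_bound (hcm g hg.continuousOn z hz) (C * H ‖z‖)
        (Filter.Eventually.of_forall fun r => ?_)
      refine (hgb _ (hFlt r z hz)).trans ?_
      exact mul_le_mul_of_nonneg_left (aux_H_mono N (norm_nonneg _) (hFle r z hz) hz) hC
    refine ⟨hI, ?_⟩
    set A : ℝ := (1 - δ + δ * ‖z‖) / (1 + δ * ‖z‖) ^ N * H ‖z‖ with hA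
    calc ∫ r, ‖g (F r z)‖ ∂μ ≤ ∫ r, C * ((q r + (1 - q r) * ‖z‖) * A) ∂μ := by
          refine integral_mono hI.norm (((hqxi _).mul_const _).const_mul _) fun r => ?_
          refine (hgb _ (hFlt r z hz)).trans ?_
          exact mul_le_mul_of_nonneg_left (aux_H_step N hδ hδ1 (norm_nonneg _) (norm_nonneg _) hz
            (hq0 r) (hq r) (hFn r z hz)) hC
      _ = C * ((m + (1 - m) * ‖z‖) * A) := by
          rw [integral_const_mul, integral_mul_const, hmint]
      _ = C * (((m + (1 - m) * ‖z‖) * ((1 - δ + δ * ‖z‖) / (1 + δ * ‖z‖) ^ N)) * H ‖z‖) := by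
          rw [hA]; ring
      _ ≤ C * ((m * θ) * H ‖z‖) := by
          refine mul_le_mul_of_nonneg_left (mul_le_mul_of_nonneg_right ?_
            (hHnn _ (norm_nonneg _) hz)) hC
          exact aux_const N₀ hδ hδ1 (norm_nonneg _) hz hqpos hN₀'
      _ = _ := by ring
  have hTd : ∀ g : ℂ → ℂ, DifferentiableOn ℂ g (ball 0 1) → ∀ B : ℝ → ℝ,
      (∀ z ρ, ‖z‖ ≤ ρ → ρ < 1 → ‖g z‖ ≤ B ρ) → DifferentiableOn ℂ (T g) (ball 0 1) := by
    intro g hg B hB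
    refine DifferentiableOn.const_mul (aux_holo μ (fun r z => g (F r z)) B ?_ ?_ ?_) _
    · intro r
      refine hg.comp (hF r) fun z hz => ?_
      rw [mem_ball_zero_iff] at hz ⊢
      exact hFlt r z hz
    · exact hcm g hg.continuousOn
    · intro r z ρ hz hρ
      exact hB _ ρ ((hFle r z (hz.trans_lt hρ)).trans hz) hρ
  have hFi : ∀ z, ‖z‖ < 1 → Integrable (fun r => F r z) μ := fun z hz =>
    Integrable.of_bound (hFm z hz).aestronglyMeasurable 1
      (Filter.Eventually.of_forall fun r => (hFlt r z hz).le)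
  -- the sequence
  let g : ℕ → ℂ → ℂ := fun n => Nat.rec (fun z => T id z - z) (fun _ h => T h) n
  have hg0 : ∀ z, g 0 z = T id z - z := fun z => rfl
  have hgs : ∀ n, g (n + 1) = T (g n) := fun n => rfl
  set C : ℝ := m⁻¹ with hC
  have hCnn : 0 ≤ C := inv_nonneg.2 hqpos.le
  have hgall : ∀ n, DifferentiableOn ℂ (g n) (ball 0 1) ∧
      ∀ z, ‖z‖ < 1 → ‖g n z‖ ≤ (C * θ ^ n) * H ‖z‖ := by
    intro n
    induction n with
    | zero =>
      constructor
      · exact (hTd id differentiableOn_id (fun ρ => ρ) (fun z ρ h _ => h)).sub differentiableOn_id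
      · intro z hz
        rw [hg0]
        have h1 : T id z - z = (m : ℂ)⁻¹ * ∫ r, (F r z - q r * z) ∂μ := by
          have hqc : Integrable (fun r => (q r : ℂ)) μ := hqi.ofReal
          have hqv : ∫ r, (q r : ℂ) ∂μ = (m : ℂ) := integral_ofReal
          rw [integral_sub (hFi z hz) (hqc.mul_const z), integral_mul_const, hqv]
          simp only [hT, id]
          field_simp
        rw [h1, norm_mul, norm_inv, Complex.norm_real, Real.norm_of_nonneg hqpos.le, pow_zero,
          mul_one]
        refine mul_le_mul_of_nonneg_left ?_ hCnn
        have h2 : ‖∫ r, (F r z - q r * z) ∂μ‖ ≤ ‖z‖ ^ 2 := by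
          have := norm_integral_le_of_norm_le_const (μ := μ) (f := fun r => F r z - q r * z)
            (C := ‖z‖ ^ 2) (Filter.Eventually.of_forall fun r => (hFb r z hz).trans
              (mul_le_of_le_one_left (by positivity) (by linarith [hq0 r])))
          simpa using this
        refine h2.trans ?_
        have hz' : 0 < 1 - ‖z‖ := by linarith
        rw [hH]
        refine le_div_self (by positivity) (by positivity) (pow_le_one₀ hz'.le ?_)
        linarith [norm_nonneg z]
    | succ n ih =>
      obtain ⟨hd, hb⟩ := ih
      have hCn : 0 ≤ C * θ ^ n := by positivity
      constructor
      · rw [hgs]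
        refine hTd _ hd (fun ρ => C * θ ^ n * H ρ) fun z ρ hz hρ => ?_
        refine (hb z (hz.trans_lt hρ)).trans ?_
        exact mul_le_mul_of_nonneg_left (aux_H_mono N (norm_nonneg _) hz hρ) hCn
      · intro z hz
        rw [hgs]
        simp only [hT]
        rw [norm_mul, norm_inv, Complex.norm_real, Real.norm_of_nonneg hqpos.le]
        have h1 := (hint _ hd _ hCn hb z hz).2
        have h2 := norm_integral_le_integral_norm (μ := μ) (fun r => g n (F r z))
        rw [inv_mul_le_iff₀ hqpos]
        refine (h2.trans h1).trans (le_of_eq ?_)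
        rw [pow_succ]; ring
  have hgeo : Summable fun n : ℕ => θ ^ n := summable_geometric_of_lt_one hθ0 hθ1
  have hsb : ∀ x : ℝ, Summable fun n : ℕ => C * θ ^ n * H x := fun x =>
    (hgeo.mul_left C).mul_right _
  have hsg : ∀ z, ‖z‖ < 1 → Summable fun n => g n z := fun z hz =>
    Summable.of_norm_bounded (hsb ‖z‖) fun n => (hgall n).2 z hz
  set D : ℝ := C * (1 - θ)⁻¹ with hD
  have hDnn : 0 ≤ D := mul_nonneg hCnn (inv_nonneg.2 (by linarith))
  have hSb : ∀ z, ‖z‖ < 1 → ‖∑' n, g n z‖ ≤ D * H ‖z‖ := by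
    intro z hz
    refine tsum_of_norm_bounded (f := fun n => g n z) ?_ fun n => (hgall n).2 z hz
    exact ((hasSum_geometric_of_lt_one hθ0 hθ1).mul_left C).mul_right _
  have hSd : DifferentiableOn ℂ (fun z => ∑' n, g n z) (ball 0 1) := by
    intro z hz
    rw [mem_ball_zero_iff] at hz
    obtain ⟨ρ, hzρ, hρ⟩ := exists_between hz
    have h1 : DifferentiableOn ℂ (fun z => ∑' n, g n z) (ball 0 ρ) := by
      refine Complex.differentiableOn_tsum_of_summable_norm (hsb ρ)
        (fun n => (hgall n).1.mono (ball_subset_ball hρ.le)) isOpen_ball ?_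
      intro n w hw
      rw [mem_ball_zero_iff] at hw
      refine ((hgall n).2 w (hw.trans hρ)).trans ?_
      exact mul_le_mul_of_nonneg_left (aux_H_mono N (norm_nonneg _) hw.le hρ) (by positivity)
    exact (h1.differentiableAt (isOpen_ball.mem_nhds (by simpa using hzρ))).differentiableWithinAt
  have hS0 : ∑' n, g n 0 = 0 := by
    have := hSb 0 (by simp)
    simpa [hH] using this
  refine ⟨fun z => z + ∑' n, g n z, ?_, ?_, ?_, ?_, ?_⟩
  · exact (differentiableOn_id.add hSd).analyticOnNhd isOpen_ball
  · simp [hS0]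
  · have hS : HasDerivAt (fun z => ∑' n, g n z) 0 0 := by
      rw [hasDerivAt_iff_isLittleO]
      simp only [hS0, sub_zero, smul_zero]
      have hO : (fun z : ℂ => ∑' n, g n z) =O[nhds 0] fun z : ℂ => ‖z‖ ^ 2 := by
        refine Asymptotics.IsBigO.of_bound (D * 2 ^ N) ?_
        filter_upwards [ball_mem_nhds (0 : ℂ) (by norm_num : (0 : ℝ) < 1 / 2)] with z hz
        rw [mem_ball_zero_iff] at hz
        refine (hSb z (by linarith)).trans ?_
        rw [mul_assoc D]
        refine mul_le_mul_of_nonneg_left ?_ hDnn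
        have h1 : (1 / 2 : ℝ) ≤ 1 - ‖z‖ := by linarith
        have h2 : (1 / 2 : ℝ) ^ N ≤ (1 - ‖z‖) ^ N := by gcongr
        simp only [hH, norm_pow, norm_norm]
        calc ‖z‖ ^ 2 / (1 - ‖z‖) ^ N ≤ ‖z‖ ^ 2 / (1 / 2) ^ N := by gcongr
          _ = _ := by rw [one_div, inv_pow, div_inv_eq_mul, mul_comm]
      refine hO.trans_isLittleO ?_
      have := Asymptotics.isLittleO_norm_pow_id (E' := ℂ) (n := 2) (by norm_num)
      exact this
    have := ((hasDerivAt_id (0 : ℂ)).add hS).deriv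
    simpa [Function.comp_def, Pi.add_def] using this
  · intro z hz
    have hi : ∀ n, Integrable (fun r => g n (F r z)) μ := fun n =>
      (hint _ (hgall n).1 (C * θ ^ n) (by positivity) (hgall n).2 z hz).1
    have hsn : Summable fun n => ∫ r, ‖g n (F r z)‖ ∂μ := by
      refine Summable.of_nonneg_of_le (fun n => integral_nonneg fun r => norm_nonneg _)
        (fun n => (hint _ (hgall n).1 (C * θ ^ n) (by positivity) (hgall n).2 z hz).2) ?_
      exact (((hgeo.mul_left C).mul_right θ).mul_right _).mul_left m
    have hts := hasSum_integral_of_summable_integral_norm hi hsn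
    have hSi : Integrable (fun r => ∑' n, g n (F r z)) μ := by
      refine Integrable.of_bound (hcm _ hSd.continuousOn z hz) (D * H ‖z‖)
        (Filter.Eventually.of_forall fun r => ?_)
      refine (hSb _ (hFlt r z hz)).trans ?_
      exact mul_le_mul_of_nonneg_left (aux_H_mono N (norm_nonneg _) (hFle r z hz) hz) hDnn
    rw [integral_add (hFi z hz) hSi, ← hts.tsum_eq]
    have h1 : ∀ n, ∫ r, g n (F r z) ∂μ = (m : ℂ) * g (n + 1) z := by
      intro n
      rw [hgs]; simp only [hT]
      rw [mul_inv_cancel_left₀ hmC]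
    have h2 : ∫ r, F r z ∂μ = (m : ℂ) * (z + g 0 z) := by
      rw [hg0]; simp only [hT, id]
      rw [add_sub_cancel, mul_inv_cancel_left₀ hmC]
    simp_rw [h1]
    rw [h2, tsum_mul_left, (hsg z hz).tsum_eq_zero_add]
    ring
  · obtain ⟨M, hM⟩ := exists_nat_ge (1 + D)
    refine ⟨-((N + M : ℕ) : ℝ), ?_, ?_⟩
    · rw [neg_lt_zero]
      have : 0 < N + M := by omega
      exact_mod_cast this
    · intro z hz
      set x := ‖z‖ with hx
      have hx0 : 0 ≤ x := norm_nonneg z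
      have hx1 : 0 < 1 - x := by linarith
      have hpN : (1 - x) ^ N ≤ 1 := pow_le_one₀ hx1.le (by linarith)
      have hpNpos : 0 < (1 - x) ^ N := by positivity
      rw [Real.rpow_neg hx1.le, Real.rpow_natCast]
      have h1 : ‖z + ∑' n, g n z‖ ≤ x + D * H x := (norm_add_le _ _).trans (by
        gcongr
        exact hSb z hz)
      refine h1.trans ?_
      have h2 : x + D * H x ≤ (M * x) / (1 - x) ^ N := by
        rw [le_div_iff₀ hpNpos, add_mul, mul_assoc]
        have : H x * (1 - x) ^ N = x ^ 2 := by simp only [hH]; field_simp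
        rw [this]
        have h3 : x * (1 - x) ^ N ≤ x := mul_le_of_le_one_right hx0 hpN
        have h4 : x ^ 2 ≤ x := by nlinarith
        nlinarith [mul_le_mul_of_nonneg_left h4 hDnn, mul_le_mul_of_nonneg_right hM hx0]
      refine h2.trans ?_
      rw [pow_add _ N M, mul_inv, div_eq_mul_inv, mul_comm]
      refine mul_le_mul_of_nonneg_left ?_ (by positivity)
      have hpM : 0 < (1 - x) ^ M := by positivity
      rw [← one_div, le_div_iff₀ hpM]
      have hb : 1 + (M : ℝ) * x ≤ (1 + x) ^ M := one_add_mul_le_pow (by linarith) M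
      calc (M : ℝ) * x * (1 - x) ^ M ≤ (1 + x) ^ M * (1 - x) ^ M := by
            gcongr; linarith
        _ = ((1 + x) * (1 - x)) ^ M := (mul_pow _ _ _).symm
        _ ≤ 1 := pow_le_one₀ (by positivity) (by nlinarith)

theorem stmt_1
    {R : Type*} [MeasurableSpace R] (μ : Measure R) [IsProbabilityMeasure μ]
    (p : R → ℕ → ℝ)
    (hp_nonneg : ∀ r n, 0 ≤ p r n)
    (hp_zero : ∀ r, p r 0 = 0)
    (hp_sum : ∀ r, ∑' n, p r n = 1)
    (hp_meas : ∀ n, Measurable fun r => p r n)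
    (hp1_pos : 0 < ∫ r, p r 1 ∂μ)
    (δ : ℝ) (hδ : δ ∈ Set.Ioo (0 : ℝ) 1)
    (hp1_sep : ∀ r, p r 1 ≤ 1 - δ) :
    ∃ Φ : ℂ → ℂ,
      AnalyticOnNhd ℂ Φ (ball (0 : ℂ) 1) ∧
      Φ 0 = 0 ∧ deriv Φ 0 = 1 ∧
      (∀ z : ℂ, ‖z‖ < 1 →
        ∫ r, Φ (∑' n, (p r n : ℂ) * z ^ n) ∂μ = ((∫ r, p r 1 ∂μ : ℝ) : ℂ) * Φ z) ∧
      ∃ α : ℝ, α < 0 ∧ ∀ z : ℂ, ‖z‖ < 1 → ‖Φ z‖ ≤ (1 - ‖z‖) ^ α := by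
  have hs : ∀ r, Summable (p r) := by
    intro r
    by_contra h
    have := tsum_eq_zero_of_not_summable h
    rw [hp_sum r] at this
    exact one_ne_zero this
  have hnb : ∀ r n (z : ℂ), ‖z‖ < 1 → ‖(p r n : ℂ) * z ^ n‖ ≤ p r n := by
    intro r n z hz
    rw [norm_mul, norm_pow, Complex.norm_real, Real.norm_of_nonneg (hp_nonneg r n)]
    exact mul_le_of_le_one_right (hp_nonneg r n) (pow_le_one₀ (norm_nonneg z) hz.le)
  have hsz : ∀ r (z : ℂ), ‖z‖ < 1 → Summable fun n => (p r n : ℂ) * z ^ n := fun r z hz =>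
    Summable.of_norm_bounded (hs r) fun n => hnb r n z hz
  refine aux_main μ (fun r z => ∑' n, (p r n : ℂ) * z ^ n) (fun r => p r 1) δ hδ.1 hδ.2
    (fun r => hp_nonneg r 1) hp1_sep (hp_meas 1) hp1_pos ?_ ?_ ?_
  · intro r
    refine Complex.differentiableOn_tsum_of_summable_norm (hs r) ?_ isOpen_ball ?_
    · intro n
      fun_prop
    · intro n w hw
      exact hnb r n w (by simpa using hw)
  · intro z hz
    refine measurable_of_tendsto_metrizable
      (f := fun (k : ℕ) r => ∑ n ∈ Finset.range k, (p r n : ℂ) * z ^ n) ?_ ?_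
    · intro k
      refine Finset.measurable_fun_sum _ fun n _ => ?_
      exact (Complex.measurable_ofReal.comp (hp_meas n)).mul_const _
    · rw [tendsto_pi_nhds]
      intro r
      exact (hsz r z hz).hasSum.tendsto_sum_nat
  · intro r z hz
    have h1 := (hsz r z hz).sum_add_tsum_nat_add 2
    have h2 := (hs r).sum_add_tsum_nat_add 2
    simp only [Finset.sum_range_succ, Finset.sum_range_zero, hp_zero r, hp_sum r] at h1 h2
    simp only [Complex.ofReal_zero, zero_mul, zero_add, pow_one] at h1 h2
    have h3 : ∑' n, (p r n : ℂ) * z ^ n - (p r 1 : ℂ) * z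
        = ∑' n, (p r (n + 2) : ℂ) * z ^ (n + 2) := by
      rw [← h1]; ring
    have h4 : 1 - p r 1 = ∑' n, p r (n + 2) := by linarith
    rw [h3, h4]
    refine tsum_of_norm_bounded
      ((((summable_nat_add_iff 2).2 (hs r)).hasSum).mul_right (‖z‖ ^ 2)) fun n => ?_
    rw [norm_mul, norm_pow, Complex.norm_real, Real.norm_of_nonneg (hp_nonneg r _)]
    refine mul_le_mul_of_nonneg_left ?_ (hp_nonneg r _)
    exact pow_le_pow_of_le_one (norm_nonneg z) hz.le (by omega)
end
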